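/- Let C be a finite-dimensional split semisimple algebra over a field K with algebra automorphism 𝔞, and let y : C → K be a K-linear map satisfying y(c c') = y(c' 𝔞(c)) for all c, c' ∈ C. Then there exist scalars b_u ∈ K, for u ∈ U^𝔞, such that y(c) = Σ_{u ∈ U^𝔞} b_u · tr(c ∘ 𝔞_u, E_u) for all c ∈ C. -/

import Mathlib

theorem aux_nondeg {K M : Type*} [Field K] [AddCommGroup M] [Module K M] [FiniteDimensional K M]
    (f : Module.End K M) (h : ∀ T : Module.End K M, LinearMap.trace K M (T * f) = 0) : f = 0 := by
  ext x
  rw [LinearMap.zero_apply, ← Module.forall_dual_apply_eq_zero_iff K]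
  intro φ
  have h1 := h (φ.smulRight x)
  have h2 : (φ.smulRight x : Module.End K M) * f = (φ ∘ₗ f).smulRight x := by
    ext z; simp
  rw [h2, LinearMap.trace_smulRight] at h1
  simpa using h1

theorem aux_rep {K M : Type*} [Field K] [AddCommGroup M] [Module K M] [FiniteDimensional K M]
    (g : Module.End K M →ₗ[K] K) :
    ∃ f : Module.End K M, ∀ T : Module.End K M, g T = LinearMap.trace K M (T * f) := by
  let Φ : Module.End K M →ₗ[K] Module.Dual K (Module.End K M) :=
    ((LinearMap.mul K (Module.End K M)).compr₂ (LinearMap.trace K M)).flip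
  have hΦ : ∀ f T, Φ f T = LinearMap.trace K M (T * f) := fun f T => rfl
  have hinj : Function.Injective Φ := by
    rw [injective_iff_map_eq_zero]
    intro f hf
    exact aux_nondeg f fun T => by rw [← hΦ, hf]; rfl
  have hs := (LinearMap.injective_iff_surjective_of_finrank_eq_finrank
    (Subspace.dual_finrank_eq (K := K) (V := Module.End K M)).symm).1 hinj
  obtain ⟨f, rfl⟩ := hs g
  exact ⟨f, fun T => hΦ f T⟩

/-- 34.14(c): if `y : C → K` is linear with `y(cc') = y(c' 𝔞(c))` on a split semisimple
finite-dimensional algebra `C` with automorphism `𝔞`, then there are scalars `b_u`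
(over the `𝔞`-fixed simple modules) with `y(c) = Σ_u b_u tr(c ∘ 𝔞_u, E_u)`. -/
theorem stmt_4 {K C : Type*} [Field K] [Ring C] [Algebra K C] [FiniteDimensional K C]
    {U V : Type*} [Fintype U] [Fintype V]
    (E : U → Type*) [∀ u, AddCommGroup (E u)] [∀ u, Module K (E u)]
    [∀ u, FiniteDimensional K (E u)]
    (ρ : ∀ u, C →ₐ[K] Module.End K (E u))
    (hsplit : Function.Bijective (fun c : C => fun u : U => ρ u c))
    (a : C ≃ₐ[K] C)
    (ι : V → U) (hι : Function.Injective ι)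
    (au : ∀ v : V, E (ι v) ≃ₗ[K] E (ι v))
    (hau : ∀ (v : V) (c : C) (x : E (ι v)), au v (ρ (ι v) c x) = ρ (ι v) (a c) (au v x))
    (hnotfix : ∀ u : U, u ∉ Set.range ι →
      ∀ f : E u →ₗ[K] E u, (∀ (c : C) (x : E u), f (ρ u c x) = ρ u (a c) (f x)) → f = 0)
    (y : C →ₗ[K] K) (hy : ∀ c c' : C, y (c * c') = y (c' * a c)) :
    ∃ bcoef : V → K, ∀ c : C,
      y c = ∑ v : V, bcoef v *
        LinearMap.trace K (E (ι v)) (ρ (ι v) c ∘ₗ (au v : E (ι v) →ₗ[K] E (ι v))) := by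
  classical
  let L : C →ₗ[K] (∀ u, Module.End K (E u)) := LinearMap.pi fun u => (ρ u).toLinearMap
  let e : C ≃ₗ[K] (∀ u, Module.End K (E u)) := LinearEquiv.ofBijective L hsplit
  have he : ∀ c u, e c u = ρ u c := fun c u => rfl
  have hrep := fun u => aux_rep (y ∘ₗ e.symm.toLinearMap ∘ₗ
    LinearMap.single K (fun u => Module.End K (E u)) u)
  choose f hf using hrep
  have hyf : ∀ c, y c = ∑ u, LinearMap.trace K (E u) (ρ u c * f u) := by
    intro c
    have h1 : c = e.symm (∑ u, Pi.single u (e c u)) := by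
      rw [Finset.univ_sum_single, e.symm_apply_apply]
    conv_lhs => rw [h1]
    rw [map_sum, map_sum]
    refine Finset.sum_congr rfl fun u _ => ?_
    rw [← hf, he]
    rfl
  have hcomm : ∀ u c, f u * ρ u c = ρ u (a c) * f u := by
    intro u c
    rw [← sub_eq_zero]
    refine aux_nondeg _ fun T => ?_
    have h2 := hy c (e.symm (Pi.single u T))
    have hsu : ρ u (e.symm (Pi.single u T)) = T := by
      rw [← he, e.apply_symm_apply, Pi.single_eq_same]
    have hsn : ∀ w, w ≠ u → ρ w (e.symm (Pi.single u T)) = 0 := fun w hw => by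
      rw [← he, e.apply_symm_apply, Pi.single_eq_of_ne hw]
    rw [hyf, hyf, Finset.sum_eq_single u, Finset.sum_eq_single u] at h2
    · rw [map_mul (ρ u), map_mul (ρ u), hsu, mul_assoc, LinearMap.trace_mul_comm] at h2
      rw [mul_sub, map_sub, ← mul_assoc, ← mul_assoc, h2, sub_self]
    · intro w _ hw
      rw [map_mul (ρ w), hsn w hw]; simp
    · simp
    · intro w _ hw
      rw [map_mul (ρ w), hsn w hw]; simp
    · simp
  have hzero : ∀ u, u ∉ Set.range ι → f u = 0 := fun u hu =>
    hnotfix u hu (f u) fun c x => LinearMap.congr_fun (hcomm u c) x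
  have hscal : ∀ v, ∃ b : K, f (ι v) = b • (au v : E (ι v) →ₗ[K] E (ι v)) := by
    intro v
    let g : Module.End K (E (ι v)) := ((au v).symm : E (ι v) →ₗ[K] E (ι v)) ∘ₗ f (ι v)
    have hg : g ∈ Subalgebra.center K (Module.End K (E (ι v))) := by
      rw [Subalgebra.mem_center_iff]
      intro T
      obtain ⟨c, hc⟩ : ∃ c, ρ (ι v) c = T :=
        ⟨e.symm (Pi.single (ι v) T), by rw [← he, e.apply_symm_apply, Pi.single_eq_same]⟩
      subst hc
      ext x
      apply (au v).injective
      have h3 := LinearMap.congr_fun (hcomm (ι v) c) x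
      simp only [Module.End.mul_apply] at h3
      simp [g, hau, h3]
    obtain ⟨b, hb⟩ := (Algebra.IsCentral.mem_center_iff K).1 hg
    refine ⟨b, ?_⟩
    ext x
    have h4 := congrArg (au v) (LinearMap.congr_fun hb x)
    simpa [g, Module.algebraMap_end_apply] using h4
  choose b hb using hscal
  refine ⟨b, fun c => ?_⟩
  rw [hyf]
  symm
  refine Finset.sum_of_injOn ι hι.injOn (by simp) ?_ ?_
  · intro u _ hu
    rw [hzero u (by simpa using hu)]; simp
  · intro v _
    rw [hb, mul_smul_comm, map_smul, smul_eq_mul]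
    rfl
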